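/- Let c be a positive natural number, α : ℝ → ℝ locally Lipschitz, strictly increasing with α(0) = 0, and k_min : Fin c → ℝ with k_min s > 0 for all s. Let k : ℝ → (Fin c → ℝ) be such that each component t ↦ k s t is differentiable on [0, ∞), k s 0 ≥ k_min s, and deriv (fun t => k s t) t ≥ −α(k s t − k_min s) for all t ≥ 0 and all s. Then k s t ≥ k_min s > 0 for all t ≥ 0 and all s; in particular every gain remains strictly positive and finite for all time. -/

import Mathlib

/-- A function that starts nonnegative and has positive derivative at every positive time where it
is negative stays nonnegative. -/
theorem nonneg_of_deriv_pos_of_neg {f : ℝ → ℝ} (hf : DifferentiableOn ℝ f (Set.Ici 0))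
    (h0 : 0 ≤ f 0) (hderiv : ∀ t > 0, f t < 0 → 0 < deriv f t) {t : ℝ} (ht : 0 ≤ t) :
    0 ≤ f t := by
  refine le_of_forall_pos_le_add fun ε hε => ?_
  have hbound : ∀ ⦃x⦄, x ∈ Set.Icc 0 t → -f x ≤ ε := by
    refine image_le_of_deriv_right_lt_deriv_boundary'
      (f := fun x => -f x) (f' := fun x => -derivWithin f (Set.Ici 0) x)
      (B := fun _ => ε) (B' := fun _ => 0)
      (hf.continuousOn.mono Set.Icc_subset_Ici_self).neg ?_ (by linarith)
      continuousOn_const (fun x _ => hasDerivWithinAt_const x _ ε) ?_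
    · intro x hx
      exact ((hf x hx.1).hasDerivWithinAt.mono (Set.Ici_subset_Ici.2 hx.1)).neg
    · intro x hx hxε
      have hneg : f x < 0 := by linarith
      have hpos : 0 < x := by
        refine lt_of_le_of_ne hx.1 ?_
        rintro rfl
        linarith
      rw [derivWithin_of_mem_nhds (Ici_mem_nhds hpos)]
      linarith [hderiv x hpos hneg]
  linarith [hbound (Set.right_mem_Icc.2 ht)]

/-- Constraint (12b) of the adaptation law keeps the gains
above their positive minimum values: if each gain `t ↦ k t s` is differentiable
on `[0, ∞)`, starts at or above `k_min s > 0`, and satisfies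
`k̇ s ≥ −α(k s − k_min s)` for a locally Lipschitz class-K∞ function `α`, then
`k t s ≥ k_min s > 0` for all `t ≥ 0` and all `s`. -/
theorem stmt_12 (c : ℕ) (hc : 0 < c)
    (α : ℝ → ℝ) (hα_lip : LocallyLipschitz α) (hα_mono : StrictMono α) (hα_zero : α 0 = 0)
    (kmin : Fin c → ℝ) (hkmin : ∀ s, 0 < kmin s)
    (k : ℝ → (Fin c → ℝ))
    (hdiff : ∀ s, DifferentiableOn ℝ (fun t => k t s) (Set.Ici 0))
    (hk0 : ∀ s, kmin s ≤ k 0 s)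
    (hineq : ∀ t ≥ (0 : ℝ), ∀ s,
      deriv (fun t => k t s) t ≥ -α (k t s - kmin s)) :
    ∀ t ≥ (0 : ℝ), ∀ s, kmin s ≤ k t s ∧ 0 < k t s := by
  intro t ht s
  have hnonneg : 0 ≤ k t s - kmin s := by
    refine nonneg_of_deriv_pos_of_neg (f := fun t => k t s - kmin s)
      ((hdiff s).sub_const _) (sub_nonneg.2 (hk0 s)) (fun x hx hneg => ?_) ht
    rw [deriv_sub_const]
    have hα := hα_mono hneg
    linarith [hineq x hx.le s]
  have hle := sub_nonneg.1 hnonneg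
  exact ⟨hle, (hkmin s).trans_le hle⟩
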